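/- Let A be an m×n integer matrix of rank n that is k-modular, and b ∈ ℤ^m such that P(A,b) = {x ∈ ℝ^n : Ax ≤ b} is a nonempty bounded polytope. If the width w(P(A,b)) is strictly greater than (Δ(A) − 1)·(Δ(A)/δ(A))·(n+1), then |P(A,b) ∩ ℤ^n| ≥ n+1. -/

import Mathlib

open Matrix

/-- The polyhedron `P(A,b) = {x ∈ ℝ^n : A x ≤ b}` of an integer matrix `A` and
integer right-hand side `b`. -/
def poly {m n : ℕ} (A : Matrix (Fin m) (Fin n) ℤ) (b : Fin m → ℤ) : Set (Fin n → ℝ) :=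
  {x | ∀ i, ((A.map (Int.cast : ℤ → ℝ)).mulVec x) i ≤ (b i : ℝ)}

/-- The lattice width of a set `P ⊆ ℝ^n`: the minimum (infimum) over nonzero integer
vectors `c` of `sup_{x ∈ P} c⋅x − inf_{x ∈ P} c⋅x`. -/
noncomputable def width {n : ℕ} (P : Set (Fin n → ℝ)) : ℝ :=
  sInf {w : ℝ | ∃ c : Fin n → ℤ, c ≠ 0 ∧
    w = sSup ((fun x : Fin n → ℝ => ∑ i, (c i : ℝ) * x i) '' P)
        - sInf ((fun x : Fin n → ℝ => ∑ i, (c i : ℝ) * x i) '' P)}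

/-- `Δ(A)`: the maximum absolute value of the determinant of an `n × n` submatrix of `A`
(an `n × n` submatrix is obtained by selecting `n` pairwise distinct rows). -/
def maxDet {m n : ℕ} (A : Matrix (Fin m) (Fin n) ℤ) : ℕ :=
  (Finset.univ.filter fun f : Fin n → Fin m => Function.Injective f).sup
    fun f => ((A.submatrix f id).det).natAbs

/-- The set of nonzero absolute values of determinants of `n × n` submatrices of `A`. -/
def detVals {m n : ℕ} (A : Matrix (Fin m) (Fin n) ℤ) : Finset ℕ :=
  ((Finset.univ.filter fun f : Fin n → Fin m => Function.Injective f).image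
    fun f => ((A.submatrix f id).det).natAbs).erase 0

/-- `Δ_lcm(A)`: least common multiple of the nonzero absolute values of the determinants
of `n × n` submatrices of `A`. -/
def lcmDet {m n : ℕ} (A : Matrix (Fin m) (Fin n) ℤ) : ℕ := (detVals A).lcm id

/-- `Δ_gcd(A)`: greatest common divisor of the nonzero absolute values of the determinants
of `n × n` submatrices of `A`. -/
def gcdDet {m n : ℕ} (A : Matrix (Fin m) (Fin n) ℤ) : ℕ := (detVals A).gcd id

/-- `δ(A)`: the minimum absolute value of the determinant of an `n × n` submatrix of `A`. -/
noncomputable def minDet {m n : ℕ} (A : Matrix (Fin m) (Fin n) ℤ) : ℕ :=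
  sInf {d : ℕ | ∃ f : Fin n → Fin m, Function.Injective f ∧ ((A.submatrix f id).det).natAbs = d}

/-- `δ(A)` for statement 1: the minimum nonzero absolute value of the determinant of an
`n × n` submatrix of `A`. -/
noncomputable def minNonzeroDet {m n : ℕ} (A : Matrix (Fin m) (Fin n) ℤ) : ℕ :=
  sInf {d : ℕ | d ∈ detVals A}

/-- Vectors with no common orthogonal vector other than `0` span the whole space. -/
lemma span_eq_top_of_dotProduct {n : ℕ} (S : Set (Fin n → ℝ))
    (h : ∀ v : Fin n → ℝ, (∀ s ∈ S, s ⬝ᵥ v = 0) → v = 0) : Submodule.span ℝ S = ⊤ := by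
  by_contra hS
  obtain ⟨f, hf0, hf⟩ := Submodule.exists_le_ker_of_lt_top _ (lt_top_iff_ne_top.2 hS)
  have hfv : ∀ s, f s = s ⬝ᵥ fun i => f (Pi.single i 1) := fun s => by
    conv_lhs => rw [pi_eq_sum_univ' s, map_sum]
    simp [dotProduct]
  have hv := h (fun i => f (Pi.single i 1)) fun s hs => by
    rw [← hfv]; exact hf (Submodule.subset_span hs)
  apply hf0
  ext s
  simp [congrFun hv]

/-- A Motzkin-type alternative for strict linear inequalities. -/
lemma exists_multipliers_of_infeasible {ι : Type*} [Fintype ι] {n : ℕ} (a : ι → Fin n → ℝ)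
    (c : ι → ℝ) (h : ¬ ∃ x, ∀ i, a i ⬝ᵥ x < c i) :
    ∃ y : ι → ℝ, (∀ i, 0 ≤ y i) ∧ y ≠ 0 ∧ ∑ i, y i • a i = 0 ∧ y ⬝ᵥ c ≤ 0 := by
  classical
  let s : Set (ι → ℝ) := Set.pi Set.univ fun _ => Set.Iio 0
  let t : Set (ι → ℝ) := Set.range fun x : Fin n → ℝ => fun i => a i ⬝ᵥ x - c i
  have hs : Convex ℝ s := convex_pi fun _ _ => convex_Iio 0
  have hso : IsOpen s := isOpen_set_pi Set.finite_univ fun _ _ => isOpen_Iio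
  have ht : Convex ℝ t := by
    rintro _ ⟨x, rfl⟩ _ ⟨x', rfl⟩ p q _ _ hpq
    refine ⟨p • x + q • x', ?_⟩
    ext i
    simp only [dotProduct_add, dotProduct_smul, Pi.add_apply, Pi.smul_apply, smul_eq_mul]
    linear_combination (c i) * hpq
  have hdisj : Disjoint s t := by
    rw [Set.disjoint_left]
    rintro _ hxs ⟨x, rfl⟩
    exact h ⟨x, fun i => sub_neg.1 (hxs i trivial)⟩
  obtain ⟨f, u, hfs, hft⟩ := geometric_hahn_banach_open hs hso ht hdisj
  set y : ι → ℝ := fun i => f (Pi.single i 1) with hy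
  have hf : ∀ w, f w = y ⬝ᵥ w := fun w => by
    conv_lhs => rw [pi_eq_sum_univ' w, map_sum]
    simp [dotProduct, hy, mul_comm]
  simp only [hf] at hfs hft
  have hone : ∀ ε > 0, y ⬝ᵥ (fun _ => -ε) < u := fun ε hε =>
    hfs _ fun i _ => neg_lt_zero.2 hε
  have hy0 : ∀ i, 0 ≤ y i := by
    intro i
    by_contra! hi
    have key : ∀ T ≥ 0, y ⬝ᵥ (fun _ => -1) + T * (-y i) < u := fun T hT => by
      have := hfs ((fun _ => -1) - T • Pi.single i 1) fun k _ => by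
        have : 0 ≤ (Pi.single i 1 : ι → ℝ) k := by
          rw [Pi.single_apply]; split_ifs <;> norm_num
        simp only [Pi.sub_apply, Pi.smul_apply, smul_eq_mul, Set.mem_Iio]
        nlinarith
      simp only [dotProduct_sub, dotProduct_smul, dotProduct_single, mul_one, smul_eq_mul] at this
      linarith
    have h0 := key 0 le_rfl
    have h1 := key ((u - y ⬝ᵥ fun _ => -1) / (-y i)) (div_nonneg (by linarith) (by linarith))
    rw [div_mul_cancel₀ _ (by linarith)] at h1
    linarith
  have hu : 0 ≤ u := by
    by_contra! hu
    have hsum : 0 ≤ ∑ i, y i := Finset.sum_nonneg fun i _ => hy0 i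
    have := hone (-u / (∑ i, y i + 1)) (div_pos (by linarith) (by linarith))
    simp only [dotProduct, ← Finset.sum_mul] at this
    have h2 : -u / (∑ i, y i + 1) * (∑ i, y i + 1) = -u := div_mul_cancel₀ _ (by linarith)
    have h3 : 0 < -u / (∑ i, y i + 1) := div_pos (by linarith) (by linarith)
    nlinarith
  have hft' : ∀ x, u ≤ (∑ i, y i • a i) ⬝ᵥ x - y ⬝ᵥ c := fun x => by
    have := hft _ ⟨x, rfl⟩
    have e : y ⬝ᵥ (fun i => a i ⬝ᵥ x - c i) = (∑ i, y i • a i) ⬝ᵥ x - y ⬝ᵥ c := by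
      rw [sum_dotProduct]
      simp [dotProduct, mul_sub, Finset.mul_sum, mul_assoc]
    rwa [e] at this
  have hc : y ⬝ᵥ c ≤ 0 := by
    have := hft' 0
    simp only [dotProduct_zero] at this
    linarith
  refine ⟨y, hy0, ?_, ?_, hc⟩
  · intro h0
    have h1 := hone 1 one_pos
    have h2 := hft' 0
    simp only [dotProduct_zero] at h2
    rw [h0, zero_dotProduct] at h1 h2
    linarith
  · set w := ∑ i, y i • a i
    rw [← dotProduct_self_eq_zero]
    have hw : 0 ≤ w ⬝ᵥ w := Finset.sum_nonneg fun i _ => mul_self_nonneg _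
    by_contra hne
    have hpos := lt_of_le_of_ne hw (Ne.symm hne)
    have := hft' (-(((-(y ⬝ᵥ c) + 1) / (w ⬝ᵥ w)) • w))
    rw [dotProduct_neg, dotProduct_smul, smul_eq_mul, div_mul_cancel₀ _ hne] at this
    linarith

/-- The multipliers witnessing infeasibility of a strict system can be chosen so that every linear
dependence among the rows they involve is proportional to them. -/
lemma exists_circuit_multipliers_of_infeasible {ι : Type*} [Fintype ι] {n : ℕ}
    (a : ι → Fin n → ℝ) (c : ι → ℝ) (h : ¬ ∃ x, ∀ i, a i ⬝ᵥ x < c i) :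
    ∃ y : ι → ℝ, (∀ i, 0 ≤ y i) ∧ y ≠ 0 ∧ ∑ i, y i • a i = 0 ∧ y ⬝ᵥ c ≤ 0 ∧
      ∀ z : ι → ℝ, ∑ i, z i • a i = 0 → (∀ i, y i = 0 → z i = 0) → ∃ t : ℝ, z = t • y := by
  classical
  let S : Set (ι → ℝ) := {y | (∀ i, 0 ≤ y i) ∧ y ≠ 0 ∧ ∑ i, y i • a i = 0 ∧ y ⬝ᵥ c ≤ 0}
  let supp : (ι → ℝ) → Finset ι := fun y => Finset.univ.filter fun i => y i ≠ 0
  obtain ⟨y, ⟨hy0, hyne, hya, hyc⟩, hmin⟩ := WellFounded.has_min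
    (InvImage.wf (fun y => (supp y).card) Nat.lt_wfRel.wf) S
    (exists_multipliers_of_infeasible a c h)
  refine ⟨y, hy0, hyne, hya, hyc, fun z hz hzy => ?_⟩
  have hsmaller : ∀ v : ι → ℝ, ∀ p q, (∀ i, 0 ≤ v i) → v q ≠ 0 → ∑ i, v i • a i = 0 →
      v ⬝ᵥ c ≤ 0 → (∀ i, y i = 0 → v i = 0) → v p = 0 → y p ≠ 0 → False := by
    intro v p q hv0 hvq hva hvc hvy hvp hyp
    refine hmin v ⟨hv0, fun hv => hvq (congrFun hv q), hva, hvc⟩ ?_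
    refine Finset.card_lt_card (Finset.ssubset_iff_of_subset ?_ |>.2 ⟨p, ?_, ?_⟩)
    · intro i hi
      simp only [supp, Finset.mem_filter, Finset.mem_univ, true_and] at hi ⊢
      exact mt (hvy i) hi
    · simpa [supp] using hyp
    · simpa [supp] using hvp
  have hne : (supp y).Nonempty := by
    obtain ⟨i, hi⟩ := Function.ne_iff.1 hyne
    exact ⟨i, by simpa [supp] using hi⟩
  obtain ⟨p, hp, hpmin⟩ := Finset.exists_min_image (supp y) (fun i => z i / y i) hne
  obtain ⟨q, hq, hqmax⟩ := Finset.exists_max_image (supp y) (fun i => z i / y i) hne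
  simp only [supp, Finset.mem_filter, Finset.mem_univ, true_and] at hp hq hpmin hqmax
  set s := z p / y p
  set s' := z q / y q with hs'
  have hlow : ∀ i, s * y i ≤ z i := fun i => by
    by_cases hi : y i = 0
    · simp [hi, hzy i hi]
    · exact (le_div_iff₀ (lt_of_le_of_ne (hy0 i) (Ne.symm hi))).1 (hpmin i hi)
  have hupp : ∀ i, z i ≤ s' * y i := fun i => by
    by_cases hi : y i = 0
    · simp [hi, hzy i hi]
    · exact (div_le_iff₀ (lt_of_le_of_ne (hy0 i) (Ne.symm hi))).1 (hqmax i hi)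
  have hzp : z p = s * y p := (div_mul_cancel₀ _ hp).symm
  have hzq : z q = s' * y q := (div_mul_cancel₀ _ hq).symm
  rcases (hpmin q hq).eq_or_lt with heq | hlt
  · refine ⟨s, funext fun i => le_antisymm ?_ (hlow i)⟩
    have := hupp i
    rwa [hs', ← heq] at this
  · exfalso
    have hyp := lt_of_le_of_ne (hy0 p) (Ne.symm hp)
    have hyq := lt_of_le_of_ne (hy0 q) (Ne.symm hq)
    rcases le_total ((z - s • y) ⬝ᵥ c) 0 with hv | hv
    · refine hsmaller (z - s • y) p q (fun i => ?_) ?_ ?_ hv (fun i hi => ?_) ?_ hp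
      · simpa using hlow i
      · simp only [Pi.sub_apply, Pi.smul_apply, smul_eq_mul, hzq, ← sub_mul]
        exact (mul_pos (sub_pos.2 hlt) hyq).ne'
      · simp only [Pi.sub_apply, Pi.smul_apply, smul_eq_mul, sub_smul, mul_smul,
          Finset.sum_sub_distrib, ← Finset.smul_sum, hz, hya, smul_zero, sub_zero]
      · simp [hi, hzy i hi]
      · simp [hzp]
    · refine hsmaller (s' • y - z) q p (fun i => ?_) ?_ ?_ ?_ (fun i hi => ?_) ?_ hq
      · simpa using hupp i
      · simp only [Pi.sub_apply, Pi.smul_apply, smul_eq_mul, hzp, ← sub_mul]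
        exact (mul_pos (sub_pos.2 hlt) hyp).ne'
      · simp only [Pi.sub_apply, Pi.smul_apply, smul_eq_mul, sub_smul, mul_smul,
          Finset.sum_sub_distrib, ← Finset.smul_sum, hz, hya, smul_zero, sub_zero]
      · simp only [sub_dotProduct, smul_dotProduct, smul_eq_mul] at hv ⊢
        nlinarith [mul_nonneg (sub_pos.2 hlt).le (neg_nonneg.2 hyc)]
      · simp [hi, hzy i hi]
      · simp [hzq]

/-- Linearly independent members of a spanning family extend to a basis drawn from the family. -/
lemma exists_basis_selection {ι : Type*} {n : ℕ} (a : ι → Fin n → ℝ)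
    {s t : Set ι} (hst : s ⊆ t) (hs : LinearIndepOn ℝ a s)
    (ht : Submodule.span ℝ (a '' t) = ⊤) :
    ∃ f : Fin n → ι, Function.Injective f ∧ LinearIndependent ℝ (a ∘ f) ∧
      s ⊆ Set.range f ∧ ∀ p, f p ∈ t := by
  obtain ⟨B, hBt, hsB, hspan, hB⟩ := exists_linearIndepOn_extension hs hst
  have htop : Submodule.span ℝ (a '' B) = ⊤ := by
    rw [eq_top_iff, ← ht]
    exact Submodule.span_le.2 hspan
  have hr : Set.range (fun i : B => a i) = a '' B := by
    ext; simp
  let bas : Module.Basis B ℝ (Fin n → ℝ) := Module.Basis.mk hB (by rw [hr, htop])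
  let e : B ≃ Fin n := bas.indexEquiv (Pi.basisFun ℝ (Fin n))
  refine ⟨fun p => e.symm p, Subtype.val_injective.comp e.symm.injective,
    LinearIndependent.comp hB e.symm e.symm.injective, fun i hi => ?_,
    fun p => hBt (e.symm p).2⟩
  exact ⟨e ⟨i, hsB hi⟩, by simp⟩

/-- The rows of an integer matrix, as real vectors. -/
def realRow {m n : ℕ} (A : Matrix (Fin m) (Fin n) ℤ) (i : Fin m) : Fin n → ℝ :=
  fun j => (A i j : ℝ)

lemma mem_poly_iff {m n : ℕ} {A : Matrix (Fin m) (Fin n) ℤ} {b : Fin m → ℤ} {x : Fin n → ℝ} :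
    x ∈ poly A b ↔ ∀ i, realRow A i ⬝ᵥ x ≤ b i := Iff.rfl

lemma det_realRow {m n : ℕ} (A : Matrix (Fin m) (Fin n) ℤ) (f : Fin n → Fin m) :
    (Matrix.of fun p => realRow A (f p)).det = ((A.submatrix f id).det : ℝ) := by
  rw [Int.cast_det]
  rfl

lemma linearIndependent_realRow_iff {m n : ℕ} (A : Matrix (Fin m) (Fin n) ℤ)
    (f : Fin n → Fin m) :
    LinearIndependent ℝ (realRow A ∘ f) ↔ (A.submatrix f id).det ≠ 0 := by
  rw [← Int.cast_ne_zero (α := ℝ), ← det_realRow, ← isUnit_iff_ne_zero,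
    ← Matrix.isUnit_iff_isUnit_det, ← Matrix.linearIndependent_rows_iff_isUnit]
  rfl

lemma injective_of_det_submatrix_ne_zero {m n : ℕ} {A : Matrix (Fin m) (Fin n) ℤ}
    {f : Fin n → Fin m} (h : (A.submatrix f id).det ≠ 0) : Function.Injective f := by
  intro p q hpq
  by_contra hne
  exact h (Matrix.det_zero_of_row_eq hne (by ext j; simp [hpq]))

lemma natAbs_det_le_maxDet {m n : ℕ} (A : Matrix (Fin m) (Fin n) ℤ) {f : Fin n → Fin m}
    (hf : Function.Injective f) : (A.submatrix f id).det.natAbs ≤ maxDet A :=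
  Finset.le_sup (f := fun f => ((A.submatrix f id).det).natAbs) (by simpa using hf)

lemma natAbs_det_mem_detVals {m n : ℕ} {A : Matrix (Fin m) (Fin n) ℤ} {f : Fin n → Fin m}
    (h : (A.submatrix f id).det ≠ 0) : (A.submatrix f id).det.natAbs ∈ detVals A := by
  refine Finset.mem_erase.2 ⟨Int.natAbs_ne_zero.2 h, Finset.mem_image.2 ⟨f, ?_, rfl⟩⟩
  simpa using injective_of_det_submatrix_ne_zero h

lemma minNonzeroDet_le {m n : ℕ} {A : Matrix (Fin m) (Fin n) ℤ} {f : Fin n → Fin m}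
    (h : (A.submatrix f id).det ≠ 0) : minNonzeroDet A ≤ (A.submatrix f id).det.natAbs :=
  Nat.sInf_le (natAbs_det_mem_detVals h)

lemma minNonzeroDet_pos {m n : ℕ} {A : Matrix (Fin m) (Fin n) ℤ} {f : Fin n → Fin m}
    (h : (A.submatrix f id).det ≠ 0) : 0 < minNonzeroDet A := by
  have hmem : minNonzeroDet A ∈ {d : ℕ | d ∈ detVals A} :=
    Nat.sInf_mem ⟨_, natAbs_det_mem_detVals h⟩
  exact Nat.pos_of_ne_zero (Finset.mem_erase.1 hmem).1

/-- A circuit of rows involves at most `n + 1` rows, and the ratio of two of its coefficients is a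
ratio of maximal subdeterminants. -/
lemma circuit_card_le_and_ratio_le {m n : ℕ} (A : Matrix (Fin m) (Fin n) ℤ)
    (hspan : Submodule.span ℝ (Set.range (realRow A)) = ⊤) (y : Fin m → ℝ) (hy0 : ∀ i, 0 ≤ y i)
    (hya : ∑ i, y i • realRow A i = 0)
    (huniq : ∀ z : Fin m → ℝ, ∑ i, z i • realRow A i = 0 → (∀ i, y i = 0 → z i = 0) →
      ∃ t : ℝ, z = t • y)
    {j : Fin m} (hj : 0 < y j) :
    (Finset.univ.filter fun i => y i ≠ 0).card ≤ n + 1 ∧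
      ∀ i, y i / y j ≤ (maxDet A : ℝ) / minNonzeroDet A := by
  classical
  let T : Finset (Fin m) := (Finset.univ.filter fun i => y i ≠ 0).erase j
  have hT : ∀ i, i ∈ T ↔ i ≠ j ∧ y i ≠ 0 := fun i => by simp [T]
  have hindep : LinearIndepOn ℝ (realRow A) (T : Set (Fin m)) := by
    rw [linearIndepOn_finset_iff]
    intro g hg i hi
    let z : Fin m → ℝ := fun i => if i ∈ T then g i else 0
    obtain ⟨t, ht⟩ := huniq z (by simpa [z, ite_smul, Finset.sum_ite_mem] using hg)
      (fun i hi => by simp [z, hT, hi])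
    have hzj : z j = 0 := by simp [z, hT]
    have ht0 : t = 0 := by
      have := congrFun ht j
      simpa [hzj, hj.ne'] using this
    have := congrFun ht i
    simpa [z, hi, ht0] using this
  obtain ⟨f, hfinj, hfind, hTf, -⟩ := exists_basis_selection (realRow A)
    (Set.subset_univ (T : Set (Fin m))) hindep (by rwa [Set.image_univ])
  have hdet := (linearIndependent_realRow_iff A f).1 hfind
  have hδ : (0 : ℝ) < minNonzeroDet A := by exact_mod_cast minNonzeroDet_pos hdet
  have hTcard : T.card ≤ n := by
    have : T ⊆ Finset.univ.image f := fun i hi => by simpa using hTf hi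
    simpa using (Finset.card_le_card this).trans Finset.card_image_le
  refine ⟨?_, fun i => ?_⟩
  · have hmem : j ∈ Finset.univ.filter fun i => y i ≠ 0 := by simpa using hj.ne'
    have := Finset.card_erase_of_mem hmem
    change T.card = _ at this
    omega
  rcases eq_or_ne (y i) 0 with hi0 | hi0
  · rw [hi0, zero_div]; positivity
  have hΔ : (minNonzeroDet A : ℝ) ≤ maxDet A := by
    exact_mod_cast (minNonzeroDet_le hdet).trans (natAbs_det_le_maxDet A hfinj)
  rcases eq_or_ne i j with rfl | hij
  · rw [div_self hi0]
    exact (one_le_div hδ).2 hΔ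
  obtain ⟨p, rfl⟩ := hTf ((hT i).2 ⟨hij, hi0⟩)
  let w : Fin n → ℝ := fun q => if f q = j then 0 else -(y (f q) / y j)
  have hrow : realRow A j = ∑ q, w q • realRow A (f q) := by
    have h1 : ∑ i ∈ T, y i • realRow A i + y j • realRow A j = 0 := by
      rw [← hya, add_comm]
      rw [Finset.add_sum_erase _ (fun i => y i • realRow A i) (by simpa using hj.ne')]
      refine Finset.sum_subset (Finset.subset_univ _) fun i _ hi => ?_
      have : y i = 0 := by simpa using hi
      simp [this]
    have h2 : ∑ q, w q • realRow A (f q) = ∑ i ∈ T, (-(y i / y j)) • realRow A i := by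
      have h3 : ∑ q, w q • realRow A (f q) = ∑ i ∈ Finset.univ.image f,
          (if i = j then 0 else -(y i / y j)) • realRow A i := by
        rw [Finset.sum_image fun _ _ _ _ h => hfinj h]
      have hTimage : T ⊆ Finset.univ.image f := fun i hi => by simpa using hTf hi
      rw [h3, ← Finset.sum_subset hTimage fun i _ hi => ?_]
      · exact Finset.sum_congr rfl fun i hi => by rw [if_neg ((hT i).1 hi).1]
      · by_cases hij : i = j
        · simp [hij]
        · have : y i = 0 := by
            by_contra h
            exact hi ((hT i).2 ⟨hij, h⟩)
          simp [this]
    have h4 : y j • realRow A j = -∑ i ∈ T, y i • realRow A i := by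
      rw [eq_neg_iff_add_eq_zero, add_comm, h1]
    rw [h2, ← inv_smul_smul₀ hj.ne' (realRow A j), h4, smul_neg, Finset.smul_sum,
      ← Finset.sum_neg_distrib]
    refine Finset.sum_congr rfl fun i _ => ?_
    rw [smul_smul, neg_smul, div_eq_inv_mul]
  let g : Fin n → Fin m := Function.update f p j
  have hdetg : ((A.submatrix g id).det : ℝ) = -(y (f p) / y j) * (A.submatrix f id).det := by
    rw [← det_realRow, ← det_realRow]
    have e : (Matrix.of fun q => realRow A (g q)) = Matrix.updateRow
        (Matrix.of fun q => realRow A (f q)) p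
        (∑ q, w q • (Matrix.of fun q => realRow A (f q)) q) := by
      have : (∑ q, w q • (Matrix.of fun q => realRow A (f q)) q) = realRow A j := hrow.symm
      rw [this]
      ext q l
      by_cases hq : q = p
      · subst hq; simp [g]
      · simp [g, hq]
    rw [e, Matrix.det_updateRow_sum]
    simp [w, hij]
  have hratio : 0 < y (f p) / y j := div_pos (lt_of_le_of_ne (hy0 _) (Ne.symm hi0)) hj
  have hdetR : ((A.submatrix f id).det : ℝ) ≠ 0 := by exact_mod_cast hdet
  have hg0 : (A.submatrix g id).det ≠ 0 := by
    rw [← Int.cast_ne_zero (α := ℝ), hdetg]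
    exact mul_ne_zero (neg_ne_zero.2 hratio.ne') hdetR
  have hg := natAbs_det_le_maxDet A (injective_of_det_submatrix_ne_zero hg0)
  have hf := minNonzeroDet_le hdet
  have habs : |((A.submatrix g id).det : ℝ)| = y (f p) / y j * |((A.submatrix f id).det : ℝ)| := by
    rw [hdetg, abs_mul, abs_neg, abs_of_pos hratio]
  have hg' : |((A.submatrix g id).det : ℝ)| ≤ maxDet A := by
    rw [← Int.cast_abs, ← Nat.cast_natAbs]; exact_mod_cast hg
  have hf' : (minNonzeroDet A : ℝ) ≤ |((A.submatrix f id).det : ℝ)| := by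
    rw [← Int.cast_abs, ← Nat.cast_natAbs]; exact_mod_cast hf
  rw [le_div_iff₀ hδ]
  calc _ ≤ y (f p) / y j * |((A.submatrix f id).det : ℝ)| :=
        mul_le_mul_of_nonneg_left hf' hratio.le
    _ ≤ _ := habs ▸ hg'

/-- The rows of `A` span if `P(A,b)` is nonempty and bounded. -/
lemma span_realRow_eq_top {m n : ℕ} {A : Matrix (Fin m) (Fin n) ℤ} {b : Fin m → ℤ}
    (hne : (poly A b).Nonempty) (hbdd : Bornology.IsBounded (poly A b)) :
    Submodule.span ℝ (Set.range (realRow A)) = ⊤ := by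
  refine span_eq_top_of_dotProduct _ fun v hv => ?_
  obtain ⟨x, hx⟩ := hne
  obtain ⟨C, hC⟩ := hbdd.exists_norm_le
  by_contra hv0
  have hmem : ∀ t : ℝ, x + t • v ∈ poly A b := fun t => mem_poly_iff.2 fun i => by
    rw [dotProduct_add, dotProduct_smul, hv _ ⟨i, rfl⟩, smul_zero, add_zero]
    exact hx i
  have hvpos : 0 < ‖v‖ := norm_pos_iff.2 hv0
  have h1 := hC _ (hmem ((2 * C + 1) / ‖v‖))
  have h2 := hC _ hx
  have h3 : ‖((2 * C + 1) / ‖v‖) • v‖ = 2 * C + 1 := by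
    have hC0 : 0 ≤ C := (norm_nonneg x).trans h2
    rw [norm_smul, Real.norm_of_nonneg (by positivity), div_mul_cancel₀ _ hvpos.ne']
  have h4 : ‖((2 * C + 1) / ‖v‖) • v‖ ≤ ‖x + ((2 * C + 1) / ‖v‖) • v‖ + ‖x‖ := by
    simpa using norm_sub_le (x + ((2 * C + 1) / ‖v‖) • v) x
  linarith

/-- The tight rows at an extreme point of `P(A,b)` contain an invertible `n × n` submatrix. -/
lemma exists_tight_basis_of_mem_extremePoints {m n : ℕ} {A : Matrix (Fin m) (Fin n) ℤ}
    {b : Fin m → ℤ} {x : Fin n → ℝ} (hx : x ∈ (poly A b).extremePoints ℝ) :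
    ∃ f : Fin n → Fin m, (A.submatrix f id).det ≠ 0 ∧ ∀ p, realRow A (f p) ⬝ᵥ x = b (f p) := by
  let t : Set (Fin m) := {i | realRow A i ⬝ᵥ x = b i}
  suffices ht : Submodule.span ℝ (realRow A '' t) = ⊤ by
    obtain ⟨f, -, hf, -, hft⟩ := exists_basis_selection (realRow A) (Set.empty_subset t)
      (linearIndepOn_empty ℝ _) ht
    exact ⟨f, (linearIndependent_realRow_iff A f).1 hf, hft⟩
  refine span_eq_top_of_dotProduct _ fun v hv => ?_
  have hopen : ∀ᶠ ε : ℝ in nhds 0, ∀ i, i ∉ t → realRow A i ⬝ᵥ (x + ε • v) < b i := by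
    refine Filter.eventually_all.2 fun i => ?_
    by_cases hi : i ∈ t
    · exact Filter.Eventually.of_forall fun _ h => absurd hi h
    have hcont : Continuous fun ε : ℝ => realRow A i ⬝ᵥ (x + ε • v) := by
      simp only [dotProduct_add, dotProduct_smul]
      fun_prop
    have hlt : realRow A i ⬝ᵥ (x + (0 : ℝ) • v) < b i := by
      rw [zero_smul, add_zero]
      exact lt_of_le_of_ne (mem_poly_iff.1 hx.1 i) hi
    exact (hcont.continuousAt.eventually_lt continuousAt_const hlt).mono fun _ h _ => h
  obtain ⟨ε, hε, hball⟩ := Metric.eventually_nhds_iff.1 hopen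
  have hmem : ∀ s : ℝ, |s| < ε → x + s • v ∈ poly A b := fun s hs => mem_poly_iff.2 fun i => by
    by_cases hi : i ∈ t
    · rw [dotProduct_add, dotProduct_smul, hv _ ⟨i, hi, rfl⟩, smul_zero, add_zero]
      exact mem_poly_iff.1 hx.1 i
    · exact (hball (by simpa using hs) i hi).le
  have h1 := hmem (ε / 2) (by rw [abs_of_pos (by positivity)]; linarith)
  have h2 := hmem (-(ε / 2)) (by rw [abs_neg, abs_of_pos (by positivity)]; linarith)
  have h3 : x ∈ openSegment ℝ (x + (ε / 2) • v) (x + (-(ε / 2)) • v) :=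
    ⟨1 / 2, 1 / 2, by norm_num, by norm_num, by norm_num, by module⟩
  have h4 := hx.2 h1 h2 h3
  have h5 : (ε / 2) • v = 0 := by simpa using h4
  exact (smul_eq_zero.1 h5).resolve_left (by positivity)

/-- If every nonzero maximal subdeterminant divides `D`, then the extreme points of
`P(A, D • q)` are integral. -/
lemma exists_int_eq_of_mem_extremePoints {m n : ℕ} {A : Matrix (Fin m) (Fin n) ℤ} {D : ℤ}
    (hD : ∀ f : Fin n → Fin m, (A.submatrix f id).det ≠ 0 → (A.submatrix f id).det ∣ D)
    {q : Fin m → ℤ} {x : Fin n → ℝ} (hx : x ∈ (poly A (D • q)).extremePoints ℝ) :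
    ∃ z : Fin n → ℤ, (fun i => (z i : ℝ)) = x := by
  obtain ⟨f, hf, hfx⟩ := exists_tight_basis_of_mem_extremePoints hx
  obtain ⟨t, ht⟩ := hD f hf
  set M := A.submatrix f id
  let z : Fin n → ℤ := t • (M.adjugate *ᵥ fun p => q (f p))
  have hz : M *ᵥ z = fun p => D * q (f p) := by
    simp only [z]
    rw [Matrix.mulVec_smul, Matrix.mulVec_mulVec, Matrix.mul_adjugate, Matrix.smul_mulVec,
      Matrix.one_mulVec, ht]
    ext p
    simp only [Pi.smul_apply, smul_eq_mul]
    ring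
  refine ⟨z, ?_⟩
  have hMdet : (M.map (Int.cast : ℤ → ℝ)).det ≠ 0 := by
    have h := Int.cast_ne_zero (α := ℝ) |>.2 hf
    rwa [Int.cast_det] at h
  have hinj := Matrix.mulVec_injective_of_isUnit
    ((Matrix.isUnit_iff_isUnit_det _).2 (isUnit_iff_ne_zero.2 hMdet))
  apply hinj
  ext p
  have h1 : (M.map (Int.cast : ℤ → ℝ) *ᵥ x) p = ((D • q) (f p) : ℤ) := hfx p
  have h2 : (M.map (Int.cast : ℤ → ℝ) *ᵥ fun i => (z i : ℝ)) p = ((M *ᵥ z) p : ℤ) := by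
    simp [Matrix.mulVec, dotProduct]
  rw [h1, h2, hz]
  simp

/-- A compact convex set with nonempty interior whose extreme points are integral has at least
`n + 1` integer points. -/
lemma exists_finset_int_of_extremePoints {n : ℕ} {Q : Set (Fin n → ℝ)} (hQ : IsCompact Q)
    (hconv : Convex ℝ Q) (hint : (interior Q).Nonempty)
    (hext : ∀ x ∈ Q.extremePoints ℝ, ∃ z : Fin n → ℤ, (fun i => (z i : ℝ)) = x) :
    ∃ S : Finset (Fin n → ℤ), n + 1 ≤ S.card ∧ ∀ z ∈ S, (fun i => (z i : ℝ)) ∈ Q := by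
  classical
  let Z : Set (Fin n → ℤ) := {z | (fun i => (z i : ℝ)) ∈ Q}
  by_cases hfin : Z.Finite
  swap
  · obtain ⟨S, hS, hcard⟩ := Set.Infinite.exists_subset_card_eq hfin (n + 1)
    exact ⟨S, hcard.ge, fun z hz => hS hz⟩
  refine ⟨hfin.toFinset, ?_, fun z hz => (hfin.mem_toFinset.1 hz)⟩
  let S : Finset (Fin n → ℝ) := hfin.toFinset.image fun z i => (z i : ℝ)
  have hsub : Q.extremePoints ℝ ⊆ (S : Set (Fin n → ℝ)) := fun x hx => by
    obtain ⟨z, rfl⟩ := hext x hx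
    simp only [S, Finset.coe_image, Set.Finite.coe_toFinset]
    exact ⟨z, hx.1, rfl⟩
  have hQS : Q ⊆ convexHull ℝ (S : Set (Fin n → ℝ)) := by
    rw [← closure_convexHull_extremePoints hQ hconv]
    exact closure_minimal (convexHull_mono hsub) (S.finite_toSet.isCompact_convexHull ℝ).isClosed
  have htop : affineSpan ℝ (S : Set (Fin n → ℝ)) = ⊤ :=
    interior_convexHull_nonempty_iff_affineSpan_eq_top.1 (hint.mono (interior_mono hQS))
  have hne : S.Nonempty := by
    rw [Finset.nonempty_iff_ne_empty]
    intro h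
    rw [h] at hQS
    obtain ⟨x, hx⟩ := hint
    simpa using hQS (interior_subset hx)
  have hvs : vectorSpan ℝ (S : Set (Fin n → ℝ)) = ⊤ := by
    rw [← direction_affineSpan, htop, AffineSubspace.direction_top]
  have hrank : Module.finrank ℝ (vectorSpan ℝ (S : Set (Fin n → ℝ))) = n := by
    rw [hvs, finrank_top, Module.finrank_fin_fun]
  have hle := finrank_vectorSpan_image_finset_le ℝ (id : (Fin n → ℝ) → Fin n → ℝ) S
    (n := S.card - 1) (by have := hne.card_pos; omega)
  rw [Finset.image_id, hrank] at hle
  have hS : S.card ≤ hfin.toFinset.card := Finset.card_image_le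
  have := hne.card_pos
  omega

lemma poly_mono {m n : ℕ} (A : Matrix (Fin m) (Fin n) ℤ) {b b' : Fin m → ℤ}
    (h : ∀ i, b' i ≤ b i) : poly A b' ⊆ poly A b :=
  fun _ hx i => (hx i).trans (by exact_mod_cast h i)

lemma isClosed_poly {m n : ℕ} (A : Matrix (Fin m) (Fin n) ℤ) (b : Fin m → ℤ) :
    IsClosed (poly A b) := by
  have : poly A b = ⋂ i, {x | realRow A i ⬝ᵥ x ≤ b i} := by
    ext; simp [mem_poly_iff]
  rw [this]
  exact isClosed_iInter fun i => isClosed_le (by fun_prop) continuous_const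

lemma convex_poly {m n : ℕ} (A : Matrix (Fin m) (Fin n) ℤ) (b : Fin m → ℤ) :
    Convex ℝ (poly A b) := by
  intro x hx x' hx' p q hp hq hpq
  refine mem_poly_iff.2 fun i => ?_
  rw [dotProduct_add, dotProduct_smul, dotProduct_smul, smul_eq_mul, smul_eq_mul]
  have h1 := mul_le_mul_of_nonneg_left (mem_poly_iff.1 hx i) hp
  have h2 := mul_le_mul_of_nonneg_left (mem_poly_iff.1 hx' i) hq
  calc _ ≤ p * (b i : ℝ) + q * b i := add_le_add h1 h2
    _ = b i := by rw [← add_mul, hpq, one_mul]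

/-- The width is at most the extent in any nonzero integer direction. -/
lemma width_le {n : ℕ} {P : Set (Fin n → ℝ)} (hne : P.Nonempty) (hP : Bornology.IsBounded P)
    {c : Fin n → ℤ} (hc : c ≠ 0) {l u : ℝ}
    (hl : ∀ x ∈ P, l ≤ ∑ i, (c i : ℝ) * x i) (hu : ∀ x ∈ P, ∑ i, (c i : ℝ) * x i ≤ u) :
    width P ≤ u - l := by
  have hbdd : BddBelow {w : ℝ | ∃ c : Fin n → ℤ, c ≠ 0 ∧
      w = sSup ((fun x : Fin n → ℝ => ∑ i, (c i : ℝ) * x i) '' P)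
        - sInf ((fun x : Fin n → ℝ => ∑ i, (c i : ℝ) * x i) '' P)} := by
    refine ⟨0, ?_⟩
    rintro _ ⟨c, -, rfl⟩
    have hb : Bornology.IsBounded ((fun x : Fin n → ℝ => ∑ i, (c i : ℝ) * x i) '' P) := by
      refine (hP.isCompact_closure.image (f := fun x : Fin n → ℝ => ∑ i, (c i : ℝ) * x i)
        (by fun_prop)).isBounded.subset (Set.image_mono subset_closure)
    exact sub_nonneg.2 (Real.sInf_le_sSup _ hb.bddBelow hb.bddAbove)
  refine (csInf_le hbdd ⟨c, hc, rfl⟩).trans (sub_le_sub ?_ ?_)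
  · exact csSup_le (hne.image _) (by rintro _ ⟨x, hx, rfl⟩; exact hu x hx)
  · exact le_csInf (hne.image _) (by rintro _ ⟨x, hx, rfl⟩; exact hl x hx)

/-- In a wide polytope, the strict inequalities remain feasible for every right-hand side within
`Δ(A) - 1` of `b`. -/
lemma exists_strictly_feasible_of_width {m n : ℕ} (A : Matrix (Fin m) (Fin n) ℤ)
    (b b' : Fin m → ℤ) (hne : (poly A b).Nonempty) (hbdd : Bornology.IsBounded (poly A b))
    (hwidth : width (poly A b) >
      ((maxDet A : ℝ) - 1) * ((maxDet A : ℝ) / (minNonzeroDet A : ℝ)) * (n + 1))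
    (hΔ : 1 ≤ maxDet A) (hb : ∀ i, b i - b' i ≤ (maxDet A : ℤ) - 1) :
    ∃ x, ∀ i, A i ≠ 0 → realRow A i ⬝ᵥ x < b' i := by
  by_contra hinf
  let c : Fin m → ℝ := fun i => if A i = 0 then 1 else b' i
  obtain ⟨y, hy0, hyne, hya, hyc, huniq⟩ :=
    exists_circuit_multipliers_of_infeasible (realRow A) c fun ⟨x, hx⟩ =>
      hinf ⟨x, fun i hi => by simpa [c, hi] using hx i⟩
  have hzero : ∀ i, A i = 0 → y i = 0 := by
    intro i hi
    by_contra hyi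
    have hri : realRow A i = 0 := by ext j; simp [realRow, hi]
    obtain ⟨t, ht⟩ := huniq (Pi.single i 1)
      (Finset.sum_eq_zero fun k _ => by
        by_cases hk : k = i
        · subst hk; simp [hri]
        · simp [hk])
      (fun k hk => by
        have : k ≠ i := fun h => hyi (h ▸ hk)
        simp [this])
    have h1 : (Pi.single i 1 : Fin m → ℝ) ⬝ᵥ c = 1 := by simp [c, hi]
    have h2 : t * y i = 1 := by simpa using (congrFun ht i).symm
    rw [ht, smul_dotProduct, smul_eq_mul] at h1
    have ht0 : 0 < t := by
      by_contra! h
      nlinarith [hy0 i]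
    nlinarith
  obtain ⟨j, hj⟩ := Function.ne_iff.1 hyne
  have hjpos : 0 < y j := lt_of_le_of_ne (hy0 j) (Ne.symm hj)
  obtain ⟨hcard, hratio⟩ := circuit_card_le_and_ratio_le A (span_realRow_eq_top hne hbdd) y hy0 hya
    huniq hjpos
  set R : ℝ := (maxDet A : ℝ) / minNonzeroDet A
  have hΔ' : (0 : ℝ) ≤ (maxDet A : ℝ) - 1 := by
    have : (1 : ℝ) ≤ maxDet A := by exact_mod_cast hΔ
    linarith
  have hyb : ∑ i, y i * (b i : ℝ) ≤ ((maxDet A : ℝ) - 1) * ∑ i, y i := by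
    have h1 : ∀ i, y i * (b i : ℝ) ≤ y i * c i + ((maxDet A : ℝ) - 1) * y i := fun i => by
      by_cases hi : A i = 0
      · simp [hzero i hi]
      · have h2 : (b i : ℝ) - b' i ≤ (maxDet A : ℝ) - 1 := by exact_mod_cast hb i
        have h3 : c i = b' i := if_neg hi
        rw [h3]
        nlinarith [mul_le_mul_of_nonneg_left h2 (hy0 i)]
    calc _ ≤ ∑ i, (y i * c i + ((maxDet A : ℝ) - 1) * y i) := Finset.sum_le_sum fun i _ => h1 i
      _ = y ⬝ᵥ c + ((maxDet A : ℝ) - 1) * ∑ i, y i := by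
        rw [Finset.sum_add_distrib, ← Finset.mul_sum]; rfl
      _ ≤ _ := by linarith
  have hsum : ∑ i, y i ≤ y j * (R * (n + 1)) := by
    have h1 : ∑ i, y i = ∑ i ∈ Finset.univ.filter fun i => y i ≠ 0, y i :=
      (Finset.sum_filter_ne_zero _).symm
    have h2 : ∀ i, y i ≤ y j * R := fun i => by
      rw [mul_comm]; exact (div_le_iff₀ hjpos).1 (hratio i)
    have hR0 : 0 ≤ y j * R := by positivity
    have hcard' : ((Finset.univ.filter fun i => y i ≠ 0).card : ℝ) ≤ n + 1 := by
      exact_mod_cast hcard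
    rw [h1]
    calc _ ≤ (Finset.univ.filter fun i => y i ≠ 0).card • (y j * R) :=
          Finset.sum_le_card_nsmul _ _ _ fun i _ => h2 i
      _ ≤ (n + 1) * (y j * R) := by
        rw [nsmul_eq_mul]; exact mul_le_mul_of_nonneg_right hcard' hR0
      _ = _ := by ring
  have hslack : ∀ x ∈ poly A b,
      (b j : ℝ) - realRow A j ⬝ᵥ x ≤ ((maxDet A : ℝ) - 1) * R * (n + 1) := by
    intro x hx
    have h1 : y j * ((b j : ℝ) - realRow A j ⬝ᵥ x) ≤
        ∑ i, y i * ((b i : ℝ) - realRow A i ⬝ᵥ x) :=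
      Finset.single_le_sum (f := fun i => y i * ((b i : ℝ) - realRow A i ⬝ᵥ x))
        (fun i _ => mul_nonneg (hy0 i) (sub_nonneg.2 (mem_poly_iff.1 hx i))) (Finset.mem_univ j)
    have h2 : ∑ i, y i * ((b i : ℝ) - realRow A i ⬝ᵥ x) = ∑ i, y i * (b i : ℝ) := by
      have : (∑ i, y i • realRow A i) ⬝ᵥ x = 0 := by rw [hya, zero_dotProduct]
      simp only [sum_dotProduct, smul_dotProduct, smul_eq_mul] at this
      simp only [mul_sub, Finset.sum_sub_distrib, this, sub_zero]
    refine le_of_mul_le_mul_left ?_ hjpos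
    calc _ ≤ _ := h1
      _ ≤ ((maxDet A : ℝ) - 1) * ∑ i, y i := h2 ▸ hyb
      _ ≤ ((maxDet A : ℝ) - 1) * (y j * (R * (n + 1))) := mul_le_mul_of_nonneg_left hsum hΔ'
      _ = _ := by ring
  have hw := width_le (c := A j) hne hbdd (fun h => hj (hzero j h))
    (l := b j - ((maxDet A : ℝ) - 1) * R * (n + 1)) (u := b j)
    (fun x hx => by
      have := hslack x hx
      simp only [dotProduct, realRow] at this
      linarith)
    (fun x hx => mem_poly_iff.1 hx j)
  linarith

/-- In a `k`-modular matrix all nonzero maximal subdeterminants divide the largest one. -/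
lemma det_dvd_maxDet {m n : ℕ} (A : Matrix (Fin m) (Fin n) ℤ) (k : ℤ)
    (hkmod : ∀ f : Fin n → Fin m, Function.Injective f →
      (A.submatrix f id).det = 0 ∨ ∃ r : ℕ,
        (A.submatrix f id).det = k ^ r ∨ (A.submatrix f id).det = -(k ^ r))
    (f : Fin n → Fin m) (hf : (A.submatrix f id).det ≠ 0) :
    (A.submatrix f id).det ∣ (maxDet A : ℤ) := by
  have hfinj := injective_of_det_submatrix_ne_zero hf
  have hpow : ∀ g : Fin n → Fin m, Function.Injective g → (A.submatrix g id).det ≠ 0 →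
      ∃ r : ℕ, (A.submatrix g id).det.natAbs = k.natAbs ^ r := by
    intro g hg hg0
    obtain ⟨r, hr | hr⟩ := (hkmod g hg).resolve_left hg0 <;>
      exact ⟨r, by rw [hr]; simp [Int.natAbs_pow]⟩
  obtain ⟨g, hg, hgmax⟩ := Finset.exists_mem_eq_sup
    (Finset.univ.filter fun f : Fin n → Fin m => Function.Injective f) ⟨f, by simpa using hfinj⟩
    fun f => ((A.submatrix f id).det).natAbs
  change maxDet A = _ at hgmax
  have hle := natAbs_det_le_maxDet A hfinj
  have hfpos := Int.natAbs_pos.2 hf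
  obtain ⟨r, hr⟩ := hpow f hfinj hf
  obtain ⟨s, hs⟩ := hpow g (by simpa using hg) (Int.natAbs_pos.1 (by omega))
  rw [← Int.natAbs_dvd_natAbs, Int.natAbs_natCast, hgmax, hs, hr]
  rcases le_total r s with h | h
  · exact pow_dvd_pow _ h
  · have h1 : k.natAbs ^ s ∣ k.natAbs ^ r := pow_dvd_pow _ h
    have h2 : k.natAbs ^ r ≤ k.natAbs ^ s := by rw [← hs, ← hr, ← hgmax]; exact hle
    rw [Nat.le_antisymm h2 (Nat.le_of_dvd (by omega) h1)]

/-- If `A` is a `k`-modular matrix of rank `n` (every `n × n` subdeterminant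
lies in `{0} ∪ {±k^r : r ∈ ℕ}`), `P(A,b)` is a nonempty bounded polytope, and the width of
`P(A,b)` exceeds `(Δ(A) − 1)·(Δ(A)/δ(A))·(n+1)` (with `δ(A)` the minimum nonzero absolute
subdeterminant), then `P(A,b)` contains at least `n + 1` integer points. -/
theorem flatness_k_modular {m n : ℕ} (A : Matrix (Fin m) (Fin n) ℤ) (b : Fin m → ℤ)
    (k : ℤ) (hk : 1 ≤ k)
    (hkmod : ∀ f : Fin n → Fin m, Function.Injective f →
      (A.submatrix f id).det = 0 ∨ ∃ r : ℕ,
        (A.submatrix f id).det = k ^ r ∨ (A.submatrix f id).det = -(k ^ r))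
    (hrank : A.rank = n)
    (hne : (poly A b).Nonempty)
    (hbdd : Bornology.IsBounded (poly A b))
    (hwidth : width (poly A b) >
      ((maxDet A : ℝ) - 1) * ((maxDet A : ℝ) / (minNonzeroDet A : ℝ)) * (n + 1)) :
    ∃ S : Finset (Fin n → ℤ), n + 1 ≤ S.card ∧
      ∀ z ∈ S, (fun i => (z i : ℝ)) ∈ poly A b := by
  obtain ⟨f, hfinj, hfind, -, -⟩ := exists_basis_selection (realRow A)
    (Set.empty_subset Set.univ) (linearIndepOn_empty ℝ _)
    (by rw [Set.image_univ]; exact span_realRow_eq_top hne hbdd)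
  have hdet := (linearIndependent_realRow_iff A f).1 hfind
  have hΔ : 1 ≤ maxDet A := (Int.natAbs_pos.2 hdet).trans_le (natAbs_det_le_maxDet A hfinj)
  let q : Fin m → ℤ := fun i => b i / (maxDet A : ℤ)
  have hq : ∀ i, ((maxDet A : ℤ) • q) i = b i - b i % (maxDet A : ℤ) := fun i => by
    have := Int.mul_ediv_add_emod (b i) (maxDet A)
    simp only [Pi.smul_apply, smul_eq_mul, q]
    linarith
  have hmod0 : ∀ i, 0 ≤ b i % (maxDet A : ℤ) := fun i => Int.emod_nonneg _ (by omega)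
  have hmod1 : ∀ i, b i % (maxDet A : ℤ) < maxDet A := fun i => Int.emod_lt_of_pos _ (by omega)
  obtain ⟨x, hx⟩ := exists_strictly_feasible_of_width A b ((maxDet A : ℤ) • q) hne hbdd hwidth hΔ
    fun i => by have := hq i; have := hmod1 i; omega
  have hsub : poly A ((maxDet A : ℤ) • q) ⊆ poly A b :=
    poly_mono A fun i => by have := hq i; have := hmod0 i; omega
  have hint : (interior (poly A ((maxDet A : ℤ) • q))).Nonempty := by
    refine ⟨x, mem_interior.2 ⟨⋂ i, {v | A i ≠ 0 → realRow A i ⬝ᵥ v < ((maxDet A : ℤ) • q) i},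
      fun v hv => mem_poly_iff.2 fun i => ?_, isOpen_iInter_of_finite fun i => ?_,
      Set.mem_iInter.2 hx⟩⟩
    · by_cases hi : A i = 0
      · obtain ⟨w, hw⟩ := hne
        have hri : realRow A i = 0 := by ext j; simp [realRow, hi]
        have hb := mem_poly_iff.1 hw i
        rw [hri, zero_dotProduct] at hb ⊢
        have hb' : 0 ≤ b i := by exact_mod_cast hb
        have : 0 ≤ ((maxDet A : ℤ) • q) i :=
          mul_nonneg (by omega) (Int.ediv_nonneg hb' (by omega))
        exact_mod_cast this
      · exact (Set.mem_iInter.1 hv i hi).le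
    · by_cases hi : A i = 0
      · simp [hi]
      · simpa [hi] using isOpen_lt (f := fun v => realRow A i ⬝ᵥ v) (by fun_prop) continuous_const
  obtain ⟨S, hS, hSQ⟩ := exists_finset_int_of_extremePoints
    (Metric.isCompact_of_isClosed_isBounded (isClosed_poly A _) (hbdd.subset hsub))
    (convex_poly A _) hint fun v hv =>
      exists_int_eq_of_mem_extremePoints (det_dvd_maxDet A k hkmod) hv
  exact ⟨S, hS, fun z hz => hsub (hSQ z hz)⟩
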